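/- Let Λ = [[A,N],[M,B]] be a null-square projective algebra over the field k with A, B, M and N finite-dimensional over k. Then for every n > 0 one has dim_k HH^n(Λ) ≥ dim_k HH^n(A) + dim_k HH^n(B). -/

import Mathlib

open scoped TensorProduct
open CategoryTheory MulOpposite

noncomputable section

/-- For a `k`-algebra `R`, `R` is a module over its enveloping algebra `R ⊗[k] Rᵐᵒᵖ`. -/
instance envModule (k R : Type) [Field k] [Ring R] [Algebra k R] :
    Module (R ⊗[k] Rᵐᵒᵖ) R := TensorProduct.Algebra.module

/-- Hochschild cohomology `HH^n(R) = Ext^n_{R ⊗[k] Rᵐᵒᵖ}(R, R)`, computed in the abelian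
category of left modules over the enveloping algebra `R ⊗[k] Rᵐᵒᵖ`. -/
def HH (k : Type) [Field k] (R : Type) [Ring R] [Algebra k R] (n : ℕ) : ModuleCat k :=
  ((Ext k (ModuleCat (R ⊗[k] Rᵐᵒᵖ)) n).obj
    (Opposite.op (ModuleCat.of (R ⊗[k] Rᵐᵒᵖ) R))).obj (ModuleCat.of (R ⊗[k] Rᵐᵒᵖ) R)

/-- The underlying `k`-vector space of `HH^n`. -/
abbrev HHt (k : Type) [Field k] (R : Type) [Ring R] [Algebra k R] (n : ℕ) : Type :=
  (HH k R n : Type)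

section

variable (k A B M N : Type) [Field k] [Ring A] [Ring B] [Algebra k A] [Algebra k B]
  [AddCommGroup M] [Module k M] [Module B M] [Module Aᵐᵒᵖ M]
  [SMulCommClass B Aᵐᵒᵖ M] [IsScalarTower k B M] [IsScalarTower k Aᵐᵒᵖ M]
  [AddCommGroup N] [Module k N] [Module A N] [Module Bᵐᵒᵖ N]
  [SMulCommClass A Bᵐᵒᵖ N] [IsScalarTower k A N] [IsScalarTower k Bᵐᵒᵖ N]

/-- The `B`-`A`-bimodule `M` as a left module over `B ⊗[k] Aᵐᵒᵖ`. -/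
instance cornerModuleM : Module (B ⊗[k] Aᵐᵒᵖ) M := TensorProduct.Algebra.module

/-- The `A`-`B`-bimodule `N` as a left module over `A ⊗[k] Bᵐᵒᵖ`. -/
instance cornerModuleN : Module (A ⊗[k] Bᵐᵒᵖ) N := TensorProduct.Algebra.module

instance cornerTowerM : IsScalarTower k (B ⊗[k] Aᵐᵒᵖ) M :=
  ⟨fun c x m => by
    show TensorProduct.Algebra.moduleAux (c • x) m = c • TensorProduct.Algebra.moduleAux x m
    rw [map_smul]; rfl⟩

instance cornerTowerN : IsScalarTower k (A ⊗[k] Bᵐᵒᵖ) N :=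
  ⟨fun c x n => by
    show TensorProduct.Algebra.moduleAux (c • x) n = c • TensorProduct.Algebra.moduleAux x n
    rw [map_smul]; rfl⟩

instance : SMulCommClass k (B ⊗[k] Aᵐᵒᵖ) M := IsScalarTower.to_smulCommClass
instance : SMulCommClass (B ⊗[k] Aᵐᵒᵖ) k M := SMulCommClass.symm _ _ _
instance : SMulCommClass k (A ⊗[k] Bᵐᵒᵖ) N := IsScalarTower.to_smulCommClass
instance : SMulCommClass (A ⊗[k] Bᵐᵒᵖ) k N := SMulCommClass.symm _ _ _

/-- Left action of `A × B` on the corner bimodule `M`: `(a,b) • m = b • m`. -/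
instance instLeftM : Module (A × B) M := Module.compHom M (RingHom.snd A B)

/-- Right action of `A × B` on `M`: `op (a,b) • m = op a • m`. -/
instance instRightM : Module (A × B)ᵐᵒᵖ M :=
  Module.compHom M (RingHom.op (RingHom.fst A B))

/-- Left action of `A × B` on the corner bimodule `N`: `(a,b) • n = a • n`. -/
instance instLeftN : Module (A × B) N := Module.compHom N (RingHom.fst A B)

/-- Right action of `A × B` on `N`: `op (a,b) • n = op b • n`. -/
instance instRightN : Module (A × B)ᵐᵒᵖ N :=
  Module.compHom N (RingHom.op (RingHom.snd A B))

instance : SMulCommClass (A × B) (A × B)ᵐᵒᵖ M :=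
  ⟨fun p q m => show p.2 • (op q.unop.1) • m = (op q.unop.1) • p.2 • m from
    smul_comm p.2 (op q.unop.1) m⟩

instance : SMulCommClass (A × B) (A × B)ᵐᵒᵖ N :=
  ⟨fun p q n => show p.1 • (op q.unop.2) • n = (op q.unop.2) • p.1 • n from
    smul_comm p.1 (op q.unop.2) n⟩

instance : IsScalarTower k (A × B) M := ⟨fun c p m => smul_assoc c p.2 m⟩
instance : IsScalarTower k (A × B) N := ⟨fun c p n => smul_assoc c p.1 n⟩
instance : IsScalarTower k (A × B)ᵐᵒᵖ M := ⟨fun c p m => smul_assoc c (op p.unop.1) m⟩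
instance : IsScalarTower k (A × B)ᵐᵒᵖ N := ⟨fun c p n => smul_assoc c (op p.unop.2) n⟩

/-- The null-square algebra `Λ = [[A,N],[M,B]]`: the trivial square-zero extension of
`A × B` by the `(A × B)`-bimodule `M × N`, where `(a,b) • (m,n) = (b•m, a•n)` and
`(m,n) • (a,b) = (m•a, n•b)`. -/
abbrev NullSq : Type := TrivSqZeroExt (A × B) (M × N)


namespace HHBar
section HHBarSec
attribute [-instance] cornerModuleM cornerModuleN cornerTowerM cornerTowerN envModule

section lift
variable {F S W X : Type} [Field F] [Ring S] [Algebra F S] [AddCommGroup W] [Module F W]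
  [AddCommGroup X] [Module F X] [Module S X] [IsScalarTower F S X]

/-- Base change lift over a noncommutative algebra. -/
def liftS (φ : W →ₗ[F] X) : S ⊗[F] W →ₗ[S] X where
  toFun := TensorProduct.lift (LinearMap.mk₂ F (fun (s : S) (w : W) => s • φ w)
    (by intros; exact add_smul _ _ _) (by intros; exact smul_assoc _ _ _)
    (by intros; rw [map_add, smul_add]) (by
      intro c s w; rw [map_smul, ← algebraMap_smul S c (φ w), ← algebraMap_smul S c (s • φ w),
        smul_smul, smul_smul, Algebra.commutes]))
  map_add' := map_add _
  map_smul' := by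
    intro s x
    induction x with
    | zero => simp
    | add x y hx hy => rw [smul_add, map_add, map_add, smul_add, hx, hy]
    | tmul t w => simp [TensorProduct.smul_tmul', mul_smul]

@[simp] theorem liftS_tmul (φ : W →ₗ[F] X) (s : S) (w : W) : liftS φ (s ⊗ₜ[F] w) = s • φ w := rfl

theorem liftS_ext {φ ψ : S ⊗[F] W →ₗ[S] X} (h : ∀ w, φ (1 ⊗ₜ w) = ψ (1 ⊗ₜ w)) : φ = ψ := by
  refine LinearMap.ext fun x => ?_
  induction x with
  | zero => simp
  | add x y hx hy => rw [map_add, map_add, hx, hy]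
  | tmul t w =>
    have : t ⊗ₜ[F] w = t • ((1 : S) ⊗ₜ[F] w) := by simp [TensorProduct.smul_tmul']
    rw [this, map_smul, map_smul, h]

instance projS : Module.Projective S (S ⊗[F] W) := by
  let b := Module.Free.chooseBasis F W
  have e : S ⊗[F] W ≃ₗ[S] (Module.Free.ChooseBasisIndex F W →₀ S) :=
    LinearEquiv.ofLinearMap
      (liftS ((b.constr F) (fun i => Finsupp.single i 1)))
      (Finsupp.linearCombination S (fun i => (1 : S) ⊗ₜ[F] b i))
      (by ext i : 3; simp [TensorProduct.smul_tmul'])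
      (by
        apply liftS_ext
        have : ((Finsupp.linearCombination S (fun i => (1 : S) ⊗ₜ[F] b i)).restrictScalars F) ∘ₗ
          ((b.constr F) (fun i => Finsupp.single i (1:S))) = TensorProduct.mk F S W 1 := by
            apply b.ext; intro i; simp
        intro w
        simpa using LinearMap.congr_fun this w)
  exact Module.Projective.of_equiv e.symm

end lift

variable (F R : Type) [Field F] [Ring R] [Algebra F R]

/-- Enveloping algebra (type synonym, to avoid instance clashes). -/
def Env := R ⊗[F] Rᵐᵒᵖ

instance : Ring (Env F R) := inferInstanceAs (Ring (R ⊗[F] Rᵐᵒᵖ))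
instance : Algebra F (Env F R) := inferInstanceAs (Algebra F (R ⊗[F] Rᵐᵒᵖ))
instance envMod : Module (Env F R) R := envModule F R

abbrev Wt (n : ℕ) := PiTensorProduct F (fun _ : Fin n => R)
abbrev Br (n : ℕ) := Env F R ⊗[F] Wt F R n

instance envTower : IsScalarTower F (Env F R) R :=
  ⟨fun c x n => LinearMap.congr_fun
    (map_smul (TensorProduct.Algebra.moduleAux (R := F) (A := R) (B := Rᵐᵒᵖ) (M := R)) c x) n⟩

variable {F R}

/-- pure tensors in the enveloping algebra. -/
def eT (r : R) (r' : Rᵐᵒᵖ) : Env F R := r ⊗ₜ[F] r'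

theorem eT_add_left (r s : R) (r' : Rᵐᵒᵖ) : (eT (r + s) r' : Env F R) = eT r r' + eT s r' :=
  TensorProduct.add_tmul _ _ _
theorem eT_add_right (r : R) (r' s' : Rᵐᵒᵖ) : (eT r (r' + s') : Env F R) = eT r r' + eT r s' :=
  TensorProduct.tmul_add _ _ _
theorem eT_smul_left (c : F) (r : R) (r' : Rᵐᵒᵖ) : (eT (c • r) r' : Env F R) = c • eT r r' := rfl
theorem eT_smul_right (c : F) (r : R) (r' : Rᵐᵒᵖ) : (eT r (c • r') : Env F R) = c • eT r r' :=
  TensorProduct.tmul_smul _ _ _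
theorem eT_mul (r s : R) (r' s' : Rᵐᵒᵖ) : (eT r r' * eT s s' : Env F R) = eT (r * s) (r' * s') :=
  Algebra.TensorProduct.tmul_mul_tmul _ _ _ _
theorem one_eq : (1 : Env F R) = eT 1 1 := rfl

theorem eT_induction {p : Env F R → Prop} (h0 : p 0) (ha : ∀ x y, p x → p y → p (x+y))
    (ht : ∀ r r', p (eT r r')) (x) : p x :=
  TensorProduct.induction_on (motive := p) x h0 ht ha

theorem env_smul (r : R) (r' : Rᵐᵒᵖ) (x : R) : (eT r r' : Env F R) • x = r * x * r'.unop := by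
  rw [mul_assoc]; rfl

/-- lift from the enveloping algebra. -/
def envLift {Y : Type} [AddCommGroup Y] [Module F Y] (β : R →ₗ[F] Rᵐᵒᵖ →ₗ[F] Y) :
    Env F R →ₗ[F] Y := TensorProduct.lift β

theorem envLift_eT {Y : Type} [AddCommGroup Y] [Module F Y] (β : R →ₗ[F] Rᵐᵒᵖ →ₗ[F] Y) (r r') :
    envLift β (eT r r') = β r r' := rfl

def consW {n : ℕ} : R →ₗ[F] Wt F R n →ₗ[F] Wt F R (n+1) :=
  (PiTensorProduct.lift (R := F) (s := fun _ : Fin n => R)).toLinearMap ∘ₗ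
    (PiTensorProduct.tprod F (s := fun _ : Fin (n+1) => R)).curryLeft

@[simp] theorem consW_tprod {n : ℕ} (r : R) (a : Fin n → R) :
    consW r (PiTensorProduct.tprod F a) =
      PiTensorProduct.tprod F (Fin.cons r a : Fin (n+1) → R) := by
  simp [consW]

variable {X : Type} [AddCommGroup X] [Module F X]

def unW {n : ℕ} (β : R →ₗ[F] Wt F R n →ₗ[F] X) : Wt F R (n+1) →ₗ[F] X :=
  PiTensorProduct.lift (LinearMap.uncurryLeft
    ((PiTensorProduct.lift (R := F) (s := fun _ : Fin n => R) (E := X)).symm.toLinearMap ∘ₗ β))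

@[simp] theorem unW_tprod {n : ℕ} (β : R →ₗ[F] Wt F R n →ₗ[F] X) (a : Fin (n+1) → R) :
    unW β (PiTensorProduct.tprod F a) = β (a 0) (PiTensorProduct.tprod F (Fin.tail a)) := by
  simp [unW]

@[simp] theorem unW_cons {n : ℕ} (β : R →ₗ[F] Wt F R n →ₗ[F] X) (r : R) (w : Wt F R n) :
    unW β (consW r w) = β r w := by
  have : unW β ∘ₗ consW r = β r := by
    ext a; simp
  exact LinearMap.congr_fun this w

theorem W_ext {n : ℕ} {φ ψ : Wt F R (n+1) →ₗ[F] X} (h : ∀ r w, φ (consW r w) = ψ (consW r w)) :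
    φ = ψ := by
  ext a
  have := h (a 0) (PiTensorProduct.tprod F (Fin.tail a))
  simpa using this

theorem Br_ext {n : ℕ} [Module (Env F R) X] [IsScalarTower F (Env F R) X]
    {φ ψ : Br F R (n+1) →ₗ[Env F R] X}
    (h : ∀ r w, φ (1 ⊗ₜ consW r w) = ψ (1 ⊗ₜ consW r w)) :
    φ = ψ := by
  apply liftS_ext
  intro w
  have : φ.restrictScalars F ∘ₗ TensorProduct.mk F _ _ 1 =
    ψ.restrictScalars F ∘ₗ TensorProduct.mk F _ _ 1 := W_ext h
  exact LinearMap.congr_fun this w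

def sB {n : ℕ} : Br F R n →ₗ[F] Br F R (n+1) :=
  TensorProduct.lift (envLift (LinearMap.mk₂ F
    (fun (r : R) (r' : Rᵐᵒᵖ) =>
      (TensorProduct.mk F (Env F R) (Wt F R (n+1)) (eT 1 r')) ∘ₗ consW r)
    (by intros; ext; simp [TensorProduct.tmul_add])
    (by intros; ext; simp)
    (by intros; ext; simp [eT_add_right, TensorProduct.add_tmul])
    (by intros; ext; simp [TensorProduct.smul_tmul', eT_smul_right])))

@[simp] theorem sB_tmul {n : ℕ} (r : R) (r' : Rᵐᵒᵖ) (w : Wt F R n) :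
    sB ((eT r r' : Env F R) ⊗ₜ w) = (eT 1 r' : Env F R) ⊗ₜ consW r w := rfl

theorem Br_induction {n : ℕ} {p : Br F R n → Prop} (h0 : p 0) (ha : ∀ x y, p x → p y → p (x+y))
    (ht : ∀ r r' w, p ((eT r r' : Env F R) ⊗ₜ w)) (x) : p x := by
  induction x using TensorProduct.induction_on with
  | zero => exact h0
  | add x y hx hy => exact ha _ _ hx hy
  | tmul s w =>
    induction s using eT_induction with
    | h0 => simpa using h0
    | ha x y hx hy => rw [TensorProduct.add_tmul]; exact ha _ _ hx hy
    | ht r r' => exact ht _ _ _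

theorem sB_right {n : ℕ} (r' : Rᵐᵒᵖ) (x : Br F R n) :
    sB ((eT 1 r' : Env F R) • x) = (eT 1 r' : Env F R) • sB x := by
  induction x using Br_induction with
  | h0 => simp
  | ha x y hx hy => rw [smul_add, map_add, hx, hy, map_add, smul_add]
  | ht r q w => simp [TensorProduct.smul_tmul', eT_mul]

/-- left multiplication by `r ⊗ 1` as bilinear map. -/
def lmulB {n : ℕ} : R →ₗ[F] Br F R n →ₗ[F] Br F R n :=
  LinearMap.mk₂ F (fun r x => (eT r 1 : Env F R) • x)
    (by intros; rw [eT_add_left, add_smul])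
    (by intros; rw [eT_smul_left, smul_assoc])
    (by intros; rw [smul_add])
    (by intro c r x; rw [smul_comm])

@[simp] theorem lmulB_apply {n : ℕ} (r : R) (x : Br F R n) : lmulB r x = (eT r 1 : Env F R) • x := rfl

/-- right multiplication by `1 ⊗ r` as bilinear map. -/
def rmulB {n : ℕ} : R →ₗ[F] Br F R n →ₗ[F] Br F R n :=
  LinearMap.mk₂ F (fun r x => (eT 1 (op r) : Env F R) • x)
    (by intros; rw [MulOpposite.op_add, eT_add_right, add_smul])
    (by intros; rw [MulOpposite.op_smul, eT_smul_right, smul_assoc])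
    (by intros; rw [smul_add])
    (by intro c r x; rw [smul_comm])

@[simp] theorem rmulB_apply {n : ℕ} (r : R) (x : Br F R n) :
    rmulB r x = (eT 1 (op r) : Env F R) • x := rfl

def one_tmul {n : ℕ} : Wt F R n →ₗ[F] Br F R n := TensorProduct.mk F _ _ 1

@[simp] theorem one_tmul_apply {n : ℕ} (w : Wt F R n) : one_tmul w = (1 : Env F R) ⊗ₜ w := rfl

/-- the pointwise difference of two bilinear maps. -/
def subB {X₁ X₂ X₃ : Type} [AddCommGroup X₁] [AddCommGroup X₂] [AddCommGroup X₃] [Module F X₁]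
    [Module F X₂] [Module F X₃] (f g : X₁ →ₗ[F] X₂ →ₗ[F] X₃) : X₁ →ₗ[F] X₂ →ₗ[F] X₃ := f - g

@[simp] theorem subB_apply {X₁ X₂ X₃ : Type} [AddCommGroup X₁] [AddCommGroup X₂] [AddCommGroup X₃]
    [Module F X₁] [Module F X₂] [Module F X₃] (f g : X₁ →ₗ[F] X₂ →ₗ[F] X₃) (x y) :
    subB f g x y = f x y - g x y := rfl

def dB : ∀ n : ℕ, Br F R (n+1) →ₗ[Env F R] Br F R n
  | 0 => liftS (unW (subB (LinearMap.compl₂ (lmulB (F := F) (R := R)) (one_tmul (F := F) (R := R)))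
      (LinearMap.compl₂ (rmulB (F := F) (R := R)) (one_tmul (F := F) (R := R)))))
  | n+1 => liftS (unW (subB
      (LinearMap.compl₂ (lmulB (F := F) (R := R)) (one_tmul (F := F) (R := R)))
      ((LinearMap.compl₂ (lmulB (F := F) (R := R))
        ((dB n).restrictScalars F ∘ₗ (one_tmul (F := F) (R := R)))).compr₂ sB)))

theorem dB_zero (s : Env F R) (r : R) (w : Wt F R 0) :
    dB 0 (s ⊗ₜ consW r w) = s • ((eT r 1 : Env F R) ⊗ₜ w - (eT 1 (op r) : Env F R) ⊗ₜ w) := by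
  simp [dB, TensorProduct.smul_tmul']

theorem dB_succ {n : ℕ} (s : Env F R) (r : R) (w : Wt F R (n+1)) :
    dB (n+1) (s ⊗ₜ consW r w) = s • ((eT r 1 : Env F R) ⊗ₜ w -
      sB (dB n ((eT r 1 : Env F R) ⊗ₜ w))) := by
  have : (eT r 1 : Env F R) ⊗ₜ w = (eT r 1 : Env F R) • ((1 : Env F R) ⊗ₜ[F] w) := by
    simp [TensorProduct.smul_tmul', eT_mul]
  rw [this, map_smul]
  simp [dB]

def εB : Br F R 0 →ₗ[Env F R] R :=
  liftS ((LinearMap.toSpanSingleton F R 1) ∘ₗ (PiTensorProduct.isEmptyEquiv (Fin 0)).toLinearMap)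

theorem εB_tmul (s : Env F R) (a : Fin 0 → R) :
    εB (s ⊗ₜ PiTensorProduct.tprod F a) = s • (1 : R) := by
  simp [εB]

def s0 : R →ₗ[F] Br F R 0 := LinearMap.flip rmulB (1 ⊗ₜ PiTensorProduct.tprod F Fin.elim0)

theorem s0_apply (r : R) : s0 r = (eT 1 (op r) : Env F R) ⊗ₜ PiTensorProduct.tprod F Fin.elim0 := by
  simp [s0, TensorProduct.smul_tmul']

theorem ε_s0 (r : R) : εB (s0 (F := F) r) = r := by
  rw [s0_apply, εB_tmul, env_smul]; simp

theorem W0_ext {φ ψ : Wt F R 0 →ₗ[F] X}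
    (h : φ (PiTensorProduct.tprod F Fin.elim0) = ψ (PiTensorProduct.tprod F Fin.elim0)) : φ = ψ := by
  ext a
  have : a = Fin.elim0 := Subsingleton.elim _ _
  subst this; exact h

theorem htpy0 (y : Br F R 0) : dB 0 (sB y) + s0 (εB y) = y := by
  induction y using Br_induction with
  | h0 => simp
  | ha x y hx hy => simp only [map_add]; nth_rw 3 [← hx]; nth_rw 3 [← hy]; abel
  | ht r q w =>
    have : ((dB 0).restrictScalars F ∘ₗ sB + s0 ∘ₗ (εB.restrictScalars F)) ∘ₗ
      TensorProduct.mk F _ _ (eT r q : Env F R) = TensorProduct.mk F _ _ (eT r q : Env F R) := by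
      apply W0_ext
      simp [-consW_tprod, dB_zero, εB_tmul, env_smul, s0_apply, TensorProduct.smul_tmul', smul_sub,
        eT_mul]
    exact LinearMap.congr_fun this w

theorem htpy {n : ℕ} (y : Br F R (n+1)) : dB (n+1) (sB y) + sB (dB n y) = y := by
  induction y using Br_induction with
  | h0 => simp
  | ha x y hx hy => simp only [map_add]; nth_rw 3 [← hx]; nth_rw 3 [← hy]; abel
  | ht r q w =>
    have h : (eT r q : Env F R) ⊗ₜ[F] w =
      (eT 1 q : Env F R) • ((eT r 1 : Env F R) ⊗ₜ[F] w) := by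
      simp [TensorProduct.smul_tmul', eT_mul]
    rw [sB_tmul, dB_succ, smul_sub, ← sB_right, ← map_smul, ← h]
    simp

theorem tmul_cons_eq {n : ℕ} (r : R) (w : Wt F R n) :
    (1 : Env F R) ⊗ₜ consW r w = sB ((eT r 1 : Env F R) ⊗ₜ w) := rfl

theorem ε_d (x : Br F R 1) : εB (dB 0 x) = 0 := by
  have : εB ∘ₗ dB 0 = (0 : Br F R 1 →ₗ[Env F R] R) := by
    refine Br_ext (F := F) ?_
    intro r w
    have : εB.restrictScalars F ∘ₗ (dB 0).restrictScalars F ∘ₗ (one_tmul (F := F) (R := R)) ∘ₗ consW r = 0 := by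
      apply W0_ext
      simp [-consW_tprod, dB_zero, εB_tmul, env_smul]
    exact LinearMap.congr_fun this w
  exact LinearMap.congr_fun this x

theorem d_d : ∀ (n : ℕ) (x : Br F R (n+2)), dB n (dB (n+1) x) = 0
  | 0, x => by
    have : dB 0 ∘ₗ dB 1 = (0 : Br F R 2 →ₗ[Env F R] _) := by
      refine Br_ext (F := F) ?_
      intro r w
      rw [tmul_cons_eq]
      set y : Br F R 1 := (eT r 1 : Env F R) ⊗ₜ w
      have h1 := htpy y
      have h2 := htpy0 (dB 0 y)
      rw [ε_d, map_zero, add_zero] at h2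
      have h3 := congrArg (dB 0) h1
      rw [map_add, h2] at h3
      simpa using h3
    exact LinearMap.congr_fun this x
  | n+1, x => by
    have : dB (n+1) ∘ₗ dB (n+2) = (0 : Br F R (n+3) →ₗ[Env F R] _) := by
      refine Br_ext (F := F) ?_
      intro r w
      rw [tmul_cons_eq]
      set y : Br F R (n+2) := (eT r 1 : Env F R) ⊗ₜ w
      have h1 := htpy y
      have h2 := htpy (dB (n+1) y)
      rw [d_d n, map_zero, add_zero] at h2
      have h3 := congrArg (dB (n+1)) h1
      rw [map_add, h2] at h3
      simpa using h3
    exact LinearMap.congr_fun this x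

end HHBarSec
end HHBar

namespace HHBar
section HHBarSec2
attribute [-instance] cornerModuleM cornerModuleN cornerTowerM cornerTowerN envModule

section res
universe v' u'
variable {C : Type u'} [Category.{v'} C] [Abelian C] (X : ℕ → C) (d : ∀ n, X (n+1) ⟶ X n)
  (sq : ∀ n, d (n+1) ≫ d n = 0) {Z : C} (ε : X 0 ⟶ Z) (hε : d 0 ≫ ε = 0)

theorem ofd (n : ℕ) : (ChainComplex.of X d sq).d (n+1) n = d n := ChainComplex.of_d X d n

theorem of_exactAt (ex : ∀ n, (ShortComplex.mk (d (n+1)) (d n) (sq n)).Exact) (n : ℕ) :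
    (ChainComplex.of X d sq).ExactAt (n+1) := by
  rw [HomologicalComplex.exactAt_iff' _ (n + 1 + 1) (n + 1) n (by simp) (by simp)]
  refine (ShortComplex.exact_iff_of_iso ?_).2 (ex n)
  exact ShortComplex.isoMk (Iso.refl _) (Iso.refl _) (Iso.refl _)
    (by
      have := ofd X d sq (n+1)
      change 𝟙 _ ≫ d (n+1) = (ChainComplex.of X d sq).d (n+1+1) (n+1) ≫ 𝟙 _
      refine Eq.trans ?_ (congrArg (fun z => z ≫ 𝟙 _) this.symm); exact (Category.id_comp _).trans (Category.comp_id _).symm) (by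
      have := ofd X d sq (n)
      change 𝟙 _ ≫ d (n) = (ChainComplex.of X d sq).d (n+1) (n) ≫ 𝟙 _
      refine Eq.trans ?_ (congrArg (fun z => z ≫ 𝟙 _) this.symm); exact (Category.id_comp _).trans (Category.comp_id _).symm)

/-- A projective resolution from explicit data. -/
def mkRes [∀ n, Projective (X n)] [Epi ε]
    (ex0 : (ShortComplex.mk (d 0) ε hε).Exact)
    (ex : ∀ n, (ShortComplex.mk (d (n+1)) (d n) (sq n)).Exact) : ProjectiveResolution Z where
  complex := ChainComplex.of X d sq
  projective n := inferInstanceAs (Projective (X n))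
  π := (ChainComplex.toSingle₀Equiv _ _).symm ⟨ε, by
          have := ofd X d sq 0
          change (ChainComplex.of X d sq).d (0+1) 0 ≫ ε = 0
          exact (congrArg (fun z => z ≫ ε) this).trans hε⟩
  quasiIso := ⟨fun n => by
    cases n
    · rw [ChainComplex.quasiIsoAt₀_iff, ShortComplex.quasiIso_iff_of_zeros']
      · refine (ShortComplex.exact_and_epi_g_iff_of_iso ?_).2
          ⟨ex0, by dsimp; infer_instance⟩
        exact ShortComplex.isoMk (Iso.refl _) (Iso.refl _) (Iso.refl _)
          (by
            have := ofd X d sq 0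
            change 𝟙 _ ≫ d 0 = (ChainComplex.of X d sq).d (0+1) 0 ≫ 𝟙 _
            refine Eq.trans ?_ (congrArg (fun z => z ≫ 𝟙 _) this.symm); exact (Category.id_comp _).trans (Category.comp_id _).symm)
          (by
            refine (Category.id_comp _).trans (Eq.trans ?_ (Category.comp_id _).symm)
            exact (ChainComplex.toSingle₀Equiv_symm_apply_f_zero (C := ChainComplex.of X d sq) ε _).symm)
      all_goals rfl
    · rw [quasiIsoAt_iff_exactAt']
      · apply of_exactAt _ _ _ ex
      · apply ChainComplex.exactAt_succ_single_obj⟩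
end res

end HHBarSec2
end HHBar

namespace HHBar
section HHBarSec3
attribute [-instance] cornerModuleM cornerModuleN cornerTowerM cornerTowerN envModule

variable (F R : Type) [Field F] [Ring R] [Algebra F R]

abbrev BrM (n : ℕ) : ModuleCat.{0} (Env F R) := ModuleCat.of (Env F R) (Br F R n)
abbrev RM : ModuleCat.{0} (Env F R) := ModuleCat.of (Env F R) R
def dM (n : ℕ) : BrM F R (n+1) ⟶ BrM F R n := ModuleCat.ofHom (dB n)
def εM : BrM F R 0 ⟶ RM F R := ModuleCat.ofHom εB

theorem dM_sq (n : ℕ) : dM F R (n+1) ≫ dM F R n = 0 := by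
  apply ModuleCat.hom_ext; refine LinearMap.ext fun x => ?_; exact d_d n x

theorem dM_ε : dM F R 0 ≫ εM F R = 0 := by
  apply ModuleCat.hom_ext; refine LinearMap.ext fun x => ?_; exact ε_d x

instance (n : ℕ) : Projective (BrM F R n) :=
  (IsProjective.iff_projective (R := Env F R) (Br F R n)).1 projS

instance : Epi (εM F R) := by
  rw [ModuleCat.epi_iff_surjective]
  intro r
  exact ⟨s0 r, ε_s0 r⟩

/-- The bar resolution. -/
def barRes : ProjectiveResolution (RM F R) :=
  mkRes (BrM F R) (dM F R) (dM_sq F R) (εM F R) (dM_ε F R)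
    (by
      rw [ShortComplex.moduleCat_exact_iff]
      intro (x : Br F R 0) (hx : εB x = 0)
      refine ⟨(sB x : Br F R 1), ?_⟩
      have := htpy0 x
      rw [hx, map_zero, add_zero] at this
      exact this)
    (by
      intro n
      rw [ShortComplex.moduleCat_exact_iff]
      intro (x : Br F R (n+1)) (hx : dB n x = 0)
      refine ⟨(sB x : Br F R (n+2)), ?_⟩
      have := htpy x
      rw [hx, map_zero, add_zero] at this
      exact this)

/-- cochains as homs of bimodules -/
def HC (n : ℕ) : ModuleCat.{0} F :=
  ((linearYoneda F (ModuleCat.{0} (Env F R))).obj (RM F R)).obj (Opposite.op (BrM F R n))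

def dC (n : ℕ) : HC F R n ⟶ HC F R (n+1) :=
  ((linearYoneda F (ModuleCat.{0} (Env F R))).obj (RM F R)).map (dM F R n).op

theorem dC_apply (n : ℕ) (φ : BrM F R n ⟶ RM F R) :
    (dC F R n).hom φ = (dM F R n ≫ φ : BrM F R (n+1) ⟶ RM F R) := rfl

theorem dC_sq (m : ℕ) : dC F R m ≫ dC F R (m+1) = 0 := by
  apply ModuleCat.hom_ext
  refine LinearMap.ext fun (x : BrM F R m ⟶ RM F R) => ?_
  show dM F R (m+1) ≫ dM F R m ≫ x = 0
  rw [← Category.assoc, dM_sq, Limits.zero_comp]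

/-- the short complex of `F`-modules. -/
def scH (m : ℕ) : ShortComplex (ModuleCat F) :=
  ShortComplex.mk (dC F R m) (dC F R (m+1)) (dC_sq F R m)

def scIso' (m : ℕ) : ((barRes F R).complex.linearYonedaObj F (RM F R)).sc' m (m+1) (m+2) ≅
    scH F R m :=
  ShortComplex.isoMk (Iso.refl (HC F R m)) (Iso.refl (HC F R (m+1))) (Iso.refl (HC F R (m+2)))
    (by
      refine (Category.id_comp _).trans (Eq.trans ?_ (Category.comp_id _).symm)
      apply ModuleCat.hom_ext
      refine LinearMap.ext fun (φ : BrM F R m ⟶ RM F R) => ?_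
      exact congrArg (fun z => z ≫ φ) (ofd (BrM F R) (dM F R) (dM_sq F R) m).symm)
    (by
      refine (Category.id_comp _).trans (Eq.trans ?_ (Category.comp_id _).symm)
      apply ModuleCat.hom_ext
      refine LinearMap.ext fun (φ : BrM F R (m+1) ⟶ RM F R) => ?_
      exact congrArg (fun z => z ≫ φ) (ofd (BrM F R) (dM F R) (dM_sq F R) (m+1)).symm)

def scIso (m : ℕ) : ((barRes F R).complex.linearYonedaObj F (RM F R)).sc (m+1) ≅ scH F R m :=
  (HomologicalComplex.isoSc' ((barRes F R).complex.linearYonedaObj F (RM F R))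
    m (m+1) (m+2) (by simp) (by simp)) ≪≫ scIso' F R m

def extEquiv (m : ℕ) : HHt F R (m+1) ≃ₗ[F]
    (LinearMap.ker (scH F R m).g.hom ⧸ LinearMap.range (scH F R m).moduleCatToCycles) :=
  (show (((Ext F (ModuleCat (Env F R)) (m+1)).obj
    (Opposite.op (RM F R))).obj (RM F R)) ≅ _ from
  ((barRes F R).isoExt (R := F) (m+1) (RM F R)) ≪≫
    ShortComplex.homologyMapIso (scIso F R m) ≪≫ (scH F R m).moduleCatHomologyIso).toLinearEquiv

end HHBarSec3
end HHBar

namespace HHBar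
section HHBarSec4
attribute [-instance] cornerModuleM cornerModuleN cornerTowerM cornerTowerN envModule

variable {F R : Type} [Field F] [Ring R] [Algebra F R]

theorem contract_zero_cons {n : ℕ} (r : R) (b : Fin (n+1) → R) :
    Fin.contractNth 0 (· * ·) (Fin.cons r b : Fin (n+2) → R) =
      (Fin.cons (r * b 0) (Fin.tail b) : Fin (n+1) → R) := by
  funext k
  refine Fin.cases ?_ (fun k => ?_) k
  · simp [Fin.contractNth]
  · simp [Fin.contractNth, Fin.tail]

theorem contract_succ_cons {n : ℕ} (j : Fin (n+1)) (r : R) (b : Fin (n+1) → R) :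
    Fin.contractNth j.succ (· * ·) (Fin.cons r b : Fin (n+2) → R) =
      (Fin.cons r (Fin.contractNth j (· * ·) b) : Fin (n+1) → R) := by
  funext k
  refine Fin.cases ?_ (fun k => ?_) k
  · simp [Fin.contractNth]
  · simp [Fin.contractNth]

theorem init_cons {n : ℕ} (r : R) (b : Fin (n+1) → R) :
    (Fin.init (Fin.cons r b : Fin (n+2) → R) : Fin (n+1) → R) = Fin.cons r (Fin.init b) := by
  funext k
  refine Fin.cases ?_ (fun k => ?_) k
  · simp [Fin.init]
  · simp [Fin.init, ← Fin.succ_castSucc]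

theorem dB_tprod : ∀ (n : ℕ) (a : Fin (n+1) → R),
    dB n ((1 : Env F R) ⊗ₜ PiTensorProduct.tprod F a) =
      (eT (a 0) 1 : Env F R) ⊗ₜ PiTensorProduct.tprod F (Fin.tail a)
      + ∑ i : Fin n, (-1 : ℤ) ^ ((i : ℕ) + 1) • ((1 : Env F R) ⊗ₜ[F]
        (PiTensorProduct.tprod F (Fin.contractNth i.castSucc (· * ·) a) : Wt F R n))
      + (-1 : ℤ) ^ (n+1) • ((eT 1 (op (a (Fin.last n))) : Env F R) ⊗ₜ[F]
        PiTensorProduct.tprod F (Fin.init a))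
  | 0, a => by
    have h : PiTensorProduct.tprod F a = consW (a 0) (PiTensorProduct.tprod F (Fin.tail a)) := by
      simp
    rw [h, dB_zero]
    have : Fin.init a = Fin.tail a := Subsingleton.elim _ _
    simp [this, sub_eq_add_neg]
  | n+1, a => by
    obtain ⟨r, b, rfl⟩ : ∃ r b, a = Fin.cons r b := ⟨a 0, Fin.tail a, (Fin.cons_self_tail a).symm⟩
    rw [← consW_tprod, dB_succ]
    have : (eT r 1 : Env F R) ⊗ₜ PiTensorProduct.tprod F b =
        (eT r 1 : Env F R) • ((1 : Env F R) ⊗ₜ[F] PiTensorProduct.tprod F b) := by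
      simp [TensorProduct.smul_tmul']
    rw [this, map_smul, dB_tprod n b]
    rw [Fin.sum_univ_succ, one_smul]
    have hs : ∀ (s t : Env F R) (j : ℕ) (w : Wt F R j), s • (t ⊗ₜ[F] w) = (s * t) ⊗ₜ[F] w :=
      fun _ _ _ _ => rfl
    simp only [smul_add, Finset.smul_sum, map_add, map_sum, smul_comm (eT r 1 : Env F R) (_ : ℤ),
      map_zsmul, hs, smul_eq_mul, eT_mul, one_eq, mul_one, one_mul,
      sB_tmul, one_smul, consW_tprod, Fin.castSucc_zero, ← Fin.succ_castSucc, contract_succ_cons,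
      contract_zero_cons, init_cons, Fin.tail_cons, Fin.cons_zero, ← Fin.succ_last, Fin.cons_succ]
    simp only [Fin.val_succ, pow_succ _ (_ + 1), mul_neg, mul_one, neg_smul, Finset.sum_neg_distrib,
      Fin.val_zero, zero_add, pow_one, one_smul]
    abel

/-- the Hochschild differential -/
def dfun {n : ℕ} (f : (Fin n → R) → R) (a : Fin (n+1) → R) : R :=
  a 0 * f (Fin.tail a) + ∑ i : Fin n, (-1 : ℤ) ^ ((i : ℕ) + 1) •
    f (Fin.contractNth i.castSucc (· * ·) a) + (-1 : ℤ) ^ (n+1) • (f (Fin.init a) * a (Fin.last n))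

abbrev ML (F R : Type) [Field F] [Ring R] [Algebra F R] (n : ℕ) :=
  MultilinearMap F (fun _ : Fin n => R) R

/-- homs of bimodules as multilinear maps -/
def θ (n : ℕ) : HC F R n ≃ₗ[F] ML F R n where
  toFun := fun (φ : BrM F R n ⟶ RM F R) =>
    (φ.hom.restrictScalars F ∘ₗ (one_tmul (F := F) (R := R))).compMultilinearMap
      (PiTensorProduct.tprod F)
  invFun := fun f => (ModuleCat.ofHom (liftS (PiTensorProduct.lift f)) : BrM F R n ⟶ RM F R)
  map_add' := fun (φ ψ : BrM F R n ⟶ RM F R) => rfl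
  map_smul' := fun c (φ : BrM F R n ⟶ RM F R) => by
    ext a
    exact algebraMap_smul (Env F R) c _
  left_inv := fun (φ : BrM F R n ⟶ RM F R) => by
    apply ModuleCat.hom_ext
    apply liftS_ext
    intro w
    have : PiTensorProduct.lift
      ((φ.hom.restrictScalars F ∘ₗ (one_tmul (F := F) (R := R))).compMultilinearMap
      (PiTensorProduct.tprod F)) = φ.hom.restrictScalars F ∘ₗ (one_tmul (F := F) (R := R)) := by
      ext a; simp
    have := LinearMap.congr_fun this w
    simpa using this
  right_inv := fun f => by
    ext a
    show liftS (PiTensorProduct.lift f) ((1 : Env F R) ⊗ₜ PiTensorProduct.tprod F a) = f a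
    simp

theorem θ_dC (n : ℕ) (φ : HC F R n) (a) : θ (n+1) ((dC F R n).hom φ) a = dfun (θ n φ) a := by
  let φ' : Br F R n →ₗ[Env F R] R := ModuleCat.Hom.hom (show BrM F R n ⟶ RM F R from φ)
  have key : ∀ r q (b : Fin n → R), φ' ((eT r q : Env F R) ⊗ₜ PiTensorProduct.tprod F b) =
     r * φ' ((1 : Env F R) ⊗ₜ PiTensorProduct.tprod F b) * q.unop := by
    intro r q b
    rw [← env_smul (F := F), ← map_smul]
    simp [TensorProduct.smul_tmul']
  show φ' (dB n ((1 : Env F R) ⊗ₜ PiTensorProduct.tprod F a)) =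
    dfun (fun b => φ' ((1 : Env F R) ⊗ₜ PiTensorProduct.tprod F b)) a
  rw [dB_tprod]
  simp only [map_add, map_sum, map_zsmul, key, dfun]
  simp

def Zc (F R : Type) [Field F] [Ring R] [Algebra F R] (n : ℕ) :
    @Submodule F (ML F R n) _ (inferInstance : AddCommGroup (ML F R n)).toAddCommMonoid
      inferInstance :=
  (LinearMap.ker (dC F R n).hom).map (θ n).toLinearMap

theorem mem_Zc {n : ℕ} {f : ML F R n} : f ∈ Zc F R n ↔ ∀ a, dfun f a = 0 := by
  constructor
  · rintro ⟨φ, hφ, rfl⟩ a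
    rw [LinearEquiv.coe_coe, ← θ_dC, show (dC F R n).hom φ = 0 from hφ, map_zero]; rfl
  · intro h
    refine ⟨(θ n).symm f, ?_, by simp⟩
    show (dC F R n).hom _ = 0
    apply (θ (n+1)).injective
    ext a
    rw [θ_dC]; simpa using h a

def Bc (F R : Type) [Field F] [Ring R] [Algebra F R] (m : ℕ) : Submodule F (Zc F R (m+1)) :=
  (LinearMap.range (scH F R m).moduleCatToCycles).map
    ((θ (m+1)).submoduleMap (LinearMap.ker (dC F R (m+1)).hom)).toLinearMap

theorem mem_Bc {m : ℕ} {f : Zc F R (m+1)} :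
    f ∈ Bc F R m ↔ ∃ g : ML F R m, ∀ a, f.1 a = dfun g a := by
  constructor
  · rintro ⟨_, ⟨φ, rfl⟩, rfl⟩
    refine ⟨θ m φ, fun a => ?_⟩
    exact θ_dC m φ a
  · rintro ⟨g, hg⟩
    refine ⟨_, ⟨(θ m).symm g, rfl⟩, ?_⟩
    apply Subtype.ext
    ext a
    rw [hg]
    refine (θ_dC m _ a).trans ?_
    simp

def hhEquiv (m : ℕ) : HHt F R (m+1) ≃ₗ[F] (Zc F R (m+1) ⧸ Bc F R m) :=
  (extEquiv F R m).trans (Submodule.Quotient.equiv _ _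
    ((θ (m+1)).submoduleMap (LinearMap.ker (dC F R (m+1)).hom)) rfl)

end HHBarSec4
end HHBar

namespace HHBar
section HHBarSec5

variable {F R S : Type} [Field F] [Ring R] [Algebra F R] [Ring S] [Algebra F S]

/-- Transport of cochains. -/
def Ψ (i : S →ₗ[F] R) (p : R →ₗ[F] S) (n : ℕ) : ML F R n →ₗ[F] ML F S n where
  toFun f := p.compMultilinearMap (f.compLinearMap (fun _ => i))
  map_add' f g := by ext a; simp
  map_smul' c f := by ext a; simp

theorem Ψ_apply (i : S →ₗ[F] R) (p : R →ₗ[F] S) (n : ℕ) (f : ML F R n) (a : Fin n → S) :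
    Ψ i p n f a = p (f (i ∘ a)) := rfl

theorem dfun_Ψ (i : S →ₗ[F] R) (p : R →ₗ[F] S) (hi : ∀ x y, i (x * y) = i x * i y)
    (hl : ∀ s x, p (i s * x) = s * p x) (hr : ∀ s x, p (x * i s) = p x * s) {n : ℕ}
    (f : ML F R n) (a : Fin (n+1) → S) :
    dfun (Ψ i p n f) a = p (dfun f (i ∘ a)) := by
  simp only [dfun, map_add, map_sum, map_zsmul, Ψ_apply, Function.comp_apply, hl, hr]
  congr 2
  refine Finset.sum_congr rfl fun j _ => ?_
  congr 3
  funext k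
  simp only [Function.comp_apply, Fin.contractNth]
  split_ifs
  · rfl
  · exact hi _ _
  · rfl

/-- Induced map on cohomology. -/
def Hmap (i : S →ₗ[F] R) (p : R →ₗ[F] S) (hi : ∀ x y, i (x * y) = i x * i y)
    (hl : ∀ s x, p (i s * x) = s * p x) (hr : ∀ s x, p (x * i s) = p x * s) (m : ℕ) :
    (Zc F R (m+1) ⧸ Bc F R m) →ₗ[F] (Zc F S (m+1) ⧸ Bc F S m) :=
  Submodule.mapQ _ _ ((Ψ i p (m+1)).restrict (p := Zc F R (m+1)) (q := Zc F S (m+1))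
    (fun f hf => by
      rw [mem_Zc] at hf ⊢
      intro a
      rw [dfun_Ψ i p hi hl hr, hf, map_zero]))
    (by
      intro f hf
      rw [mem_Bc] at hf
      obtain ⟨g, hg⟩ := hf
      rw [Submodule.mem_comap, mem_Bc]
      refine ⟨Ψ i p m g, fun a => ?_⟩
      rw [dfun_Ψ i p hi hl hr, ← hg]
      rfl)

theorem rank_ineq {A B L : Type} [Ring A] [Ring B] [Ring L] [Algebra F A] [Algebra F B]
    [Algebra F L]
    (i : A →ₗ[F] L) (p : L →ₗ[F] A) (hi : ∀ x y, i (x * y) = i x * i y)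
    (hl : ∀ s x, p (i s * x) = s * p x) (hr : ∀ s x, p (x * i s) = p x * s)
    (i' : B →ₗ[F] L) (p' : L →ₗ[F] B) (hi' : ∀ x y, i' (x * y) = i' x * i' y)
    (hl' : ∀ s x, p' (i' s * x) = s * p' x) (hr' : ∀ s x, p' (x * i' s) = p' x * s) (m : ℕ)
    (H : ∀ f ∈ Zc F A (m+1), ∀ g ∈ Zc F B (m+1), ∃ h ∈ Zc F L (m+1),
      (∀ a, p (h (i ∘ a)) = f a) ∧ (∀ b, p' (h (i' ∘ b)) = g b)) :
    Module.rank F (HHt F A (m+1)) + Module.rank F (HHt F B (m+1)) ≤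
      Module.rank F (HHt F L (m+1)) := by
  rw [(hhEquiv (F := F) (R := A) m).rank_eq, (hhEquiv (F := F) (R := B) m).rank_eq,
    (hhEquiv (F := F) (R := L) m).rank_eq, ← rank_prod']
  refine LinearMap.rank_le_of_surjective
    ((Hmap i p hi hl hr m).prod (Hmap i' p' hi' hl' hr' m)) ?_
  rintro ⟨x, y⟩
  obtain ⟨⟨f, hf⟩, rfl⟩ := Submodule.mkQ_surjective _ x
  obtain ⟨⟨g, hg⟩, rfl⟩ := Submodule.mkQ_surjective _ y
  obtain ⟨h, hh, h1, h2⟩ := H f hf g hg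
  refine ⟨Submodule.mkQ _ ⟨h, hh⟩, ?_⟩
  refine Prod.ext ?_ ?_
  · refine congrArg (Submodule.mkQ (Bc F A m)) (Subtype.ext ?_)
    exact MultilinearMap.ext h1
  · refine congrArg (Submodule.mkQ (Bc F B m)) (Subtype.ext ?_)
    exact MultilinearMap.ext h2

end HHBarSec5
end HHBar

namespace HHBar
section HHBarSec6

section snoc
variable {R : Type} [Mul R]

theorem contract_last_snoc {m : ℕ} (b : Fin (m+1) → R) (l : R) :
    Fin.contractNth (Fin.last m).castSucc (· * ·) (Fin.snoc b l : Fin (m+2) → R) =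
      (Fin.snoc (Fin.init b) (b (Fin.last m) * l) : Fin (m+1) → R) := by
  funext k
  refine Fin.lastCases ?_ (fun k => ?_) k
  · simp [Fin.contractNth]
  · simp [Fin.contractNth, Fin.init]

theorem contract_castSucc_snoc {m : ℕ} (j : Fin m) (b : Fin (m+1) → R) (l : R) :
    Fin.contractNth j.castSucc.castSucc (· * ·) (Fin.snoc b l : Fin (m+2) → R) =
      (Fin.snoc (Fin.contractNth j.castSucc (· * ·) b) l : Fin (m+1) → R) := by
  funext k
  refine Fin.lastCases ?_ (fun k => ?_) k
  · have h1 : ¬ (m < (j : ℕ)) := by omega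
    have h2 : ¬ (m = (j : ℕ)) := by omega
    simp [Fin.contractNth, h1, h2]
  · simp only [Fin.contractNth, Fin.snoc_castSucc, Fin.val_castSucc, Fin.succ_castSucc]

theorem tail_snoc {m : ℕ} (b : Fin (m+1) → R) (l : R) :
    (Fin.tail (Fin.snoc b l : Fin (m+2) → R) : Fin (m+1) → R) = Fin.snoc (Fin.tail b) l := by
  funext k
  refine Fin.lastCases ?_ (fun k => ?_) k
  · simp only [Fin.tail, Fin.succ_last, Fin.snoc_last]
  · simp only [Fin.tail, Fin.succ_castSucc, Fin.snoc_castSucc]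
end snoc

variable {F C V : Type} [Field F] [Ring C] [Algebra F C] [AddCommGroup V] [Module F V]
  [Module C V] [Module Cᵐᵒᵖ V] [SMulCommClass C Cᵐᵒᵖ V] [IsScalarTower F C V]
  [IsScalarTower F Cᵐᵒᵖ V]

/-- The extension operator in the slot `q`. -/
def GG {n : ℕ} (T : (C →ₗ[F] C) →ₗ[F] (V →ₗ[F] V)) (f : ML F C n) (q : Fin n) :
    MultilinearMap F (fun _ : Fin n => TrivSqZeroExt C V) V where
  toFun l := T (f.toLinearMap (fun k => (l k).fst) q) (l q).snd
  map_update_add' := by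
    intro hd l k x y
    have e : hd = instDecidableEqFin n := Subsingleton.elim _ _
    subst e
    by_cases h : k = q
    · subst h
      have : ∀ z : TrivSqZeroExt C V, f.toLinearMap (fun j => (Function.update l k z j).fst) k =
          f.toLinearMap (fun j => (l j).fst) k := by
        intro z; ext t
        simp only [MultilinearMap.toLinearMap_apply]
        congr 1; funext j
        by_cases hj : j = k
        · subst hj; simp
        · simp [hj]
      simp [this]
    · have : ∀ z : TrivSqZeroExt C V, f.toLinearMap (fun j => (Function.update l k z j).fst) q =
          f.toLinearMap (Function.update (fun j => (l j).fst) k z.fst) q := by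
        intro z; congr 1; funext j
        by_cases hj : j = k
        · subst hj; simp
        · simp [hj]
      have h3 : f.toLinearMap (Function.update (fun j => (l j).fst) k (x+y).fst) q =
        f.toLinearMap (Function.update (fun j => (l j).fst) k x.fst) q +
        f.toLinearMap (Function.update (fun j => (l j).fst) k y.fst) q := by
        ext t
        simp only [MultilinearMap.toLinearMap_apply, LinearMap.add_apply, TrivSqZeroExt.fst_add,
          Function.update_comm h, MultilinearMap.map_update_add]
      simp only [this, h3, map_add, LinearMap.add_apply, Function.update_of_ne (Ne.symm h)]
  map_update_smul' := by
    intro hd l k c x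
    have e : hd = instDecidableEqFin n := Subsingleton.elim _ _
    subst e
    by_cases h : k = q
    · subst h
      have : ∀ z : TrivSqZeroExt C V, f.toLinearMap (fun j => (Function.update l k z j).fst) k =
          f.toLinearMap (fun j => (l j).fst) k := by
        intro z; ext t
        simp only [MultilinearMap.toLinearMap_apply]
        congr 1; funext j
        by_cases hj : j = k
        · subst hj; simp
        · simp [hj]
      simp [this]
    · have : ∀ z : TrivSqZeroExt C V, f.toLinearMap (fun j => (Function.update l k z j).fst) q =
          f.toLinearMap (Function.update (fun j => (l j).fst) k z.fst) q := by
        intro z; congr 1; funext j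
        by_cases hj : j = k
        · subst hj; simp
        · simp [hj]
      have h3 : f.toLinearMap (Function.update (fun j => (l j).fst) k (c • x).fst) q =
        c • f.toLinearMap (Function.update (fun j => (l j).fst) k x.fst) q := by
        ext t
        simp only [MultilinearMap.toLinearMap_apply, LinearMap.smul_apply, TrivSqZeroExt.fst_smul,
          Function.update_comm h, MultilinearMap.map_update_smul]
      simp only [this, h3, map_smul, LinearMap.smul_apply, Function.update_of_ne (Ne.symm h)]

abbrev φL {m : ℕ} (f : ML F C (m+1)) (t : Fin m → C) : C →ₗ[F] C :=
  f.toLinearMap (Fin.cons 0 t) 0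
abbrev φR {m : ℕ} (f : ML F C (m+1)) (t : Fin m → C) : C →ₗ[F] C :=
  f.toLinearMap (Fin.snoc t 0) (Fin.last m)

theorem φL_apply {m : ℕ} (f : ML F C (m+1)) (t : Fin m → C) (x : C) :
    φL f t x = f (Fin.cons x t) := by
  simp [φL]
theorem φR_apply {m : ℕ} (f : ML F C (m+1)) (t : Fin m → C) (x : C) :
    φR f t x = f (Fin.snoc t x) := by
  rw [φR, MultilinearMap.toLinearMap_apply]
  congr 1
  funext k
  refine Fin.lastCases ?_ (fun k => ?_) k <;> simp

theorem GG_cons {m : ℕ} (T : (C →ₗ[F] C) →ₗ[F] (V →ₗ[F] V)) (f : ML F C (m+1))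
    (l : TrivSqZeroExt C V) (b : Fin m → TrivSqZeroExt C V) :
    GG T f 0 (Fin.cons l b) = T (φL f (fun k => (b k).fst)) l.snd := by
  show T _ _ = _
  congr 2
  ext x
  rw [φL_apply, MultilinearMap.toLinearMap_apply]
  congr 1
  funext k
  refine Fin.cases ?_ (fun k => ?_) k <;> simp

theorem GG_snoc {m : ℕ} (T : (C →ₗ[F] C) →ₗ[F] (V →ₗ[F] V)) (f : ML F C (m+1))
    (l : TrivSqZeroExt C V) (b : Fin m → TrivSqZeroExt C V) :
    GG T f (Fin.last m) (Fin.snoc b l : Fin (m+1) → TrivSqZeroExt C V) =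
      T (φR f (fun k => (b k).fst)) l.snd := by
  show T _ _ = _
  rw [Fin.snoc_last]
  congr 2
  ext x
  rw [φR_apply, MultilinearMap.toLinearMap_apply]
  congr 1
  funext k
  refine Fin.lastCases ?_ (fun k => ?_) k <;> simp

theorem fst_contract {n : ℕ} (j : Fin (n+1)) (b : Fin (n+1) → TrivSqZeroExt C V) :
    (fun k => (Fin.contractNth j (· * ·) b k).fst) =
      Fin.contractNth j (· * ·) (fun k => (b k).fst) := by
  funext k
  simp only [Fin.contractNth]
  split_ifs <;> simp

end HHBarSec6
end HHBar

namespace HHBar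
section HHBarSec7

variable {F C V : Type} [Field F] [Ring C] [Algebra F C] [AddCommGroup V] [Module F V]
  [Module C V] [Module Cᵐᵒᵖ V] [SMulCommClass C Cᵐᵒᵖ V] [IsScalarTower F C V]
  [IsScalarTower F Cᵐᵒᵖ V]

theorem eqL {m : ℕ} (f : ML F C (m+1)) (hf : ∀ a, dfun f a = 0) (c : Fin (m+1) → C) :
    LinearMap.mulRight F (f c) - φL f (Fin.tail c) ∘ₗ LinearMap.mulRight F (c 0)
      + ∑ j : Fin m, (-1 : ℤ) ^ ((j : ℕ) + 2) • φL f (Fin.contractNth j.castSucc (· * ·) c)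
      + (-1 : ℤ) ^ (m+2) • (LinearMap.mulRight F (c (Fin.last m)) ∘ₗ φL f (Fin.init c)) = 0 := by
  ext x
  have h := hf (Fin.cons x c)
  rw [dfun, Fin.sum_univ_succ] at h
  simp only [Fin.castSucc_zero, ← Fin.succ_castSucc, contract_succ_cons,
      contract_zero_cons, init_cons, Fin.tail_cons, Fin.cons_zero, ← Fin.succ_last, Fin.cons_succ,
      Fin.val_zero, Fin.val_succ, zero_add, pow_one, neg_smul, one_smul] at h
  simp only [LinearMap.add_apply, LinearMap.sub_apply, LinearMap.sum_apply, LinearMap.comp_apply,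
    LinearMap.smul_apply, LinearMap.mulRight_apply, φL_apply, LinearMap.zero_apply]
  rw [← h]
  abel

theorem eqR {m : ℕ} (f : ML F C (m+1)) (hf : ∀ a, dfun f a = 0) (c : Fin (m+1) → C) :
    LinearMap.mulLeft F (c 0) ∘ₗ φR f (Fin.tail c)
      + ∑ j : Fin m, (-1 : ℤ) ^ ((j : ℕ) + 1) • φR f (Fin.contractNth j.castSucc (· * ·) c)
      + (-1 : ℤ) ^ (m+1) • (φR f (Fin.init c) ∘ₗ LinearMap.mulLeft F (c (Fin.last m)))
      + (-1 : ℤ) ^ (m+2) • LinearMap.mulLeft F (f c) = 0 := by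
  ext x
  have h := hf (Fin.snoc c x)
  rw [dfun, Fin.sum_univ_castSucc] at h
  have e0 : (Fin.snoc c x : Fin (m+2) → C) 0 = c 0 := by
    rw [← Fin.castSucc_zero]; exact Fin.snoc_castSucc (α := fun _ => C) _ _ _
  simp only [contract_last_snoc, contract_castSucc_snoc, tail_snoc, Fin.init_snoc, Fin.snoc_last,
    e0, Fin.val_castSucc, Fin.val_last] at h
  simp only [LinearMap.add_apply, LinearMap.sum_apply, LinearMap.comp_apply,
    LinearMap.smul_apply, LinearMap.mulLeft_apply, φR_apply, LinearMap.zero_apply]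
  rw [← h]
  abel

theorem dGL {m : ℕ} (f : ML F C (m+1)) (hf : ∀ a, dfun f a = 0)
    (T : (C →ₗ[F] C) →ₗ[F] (V →ₗ[F] V))
    (h1 : ∀ φ (c : C) (v : V), T φ (c • v) = c • T φ v)
    (h2 : ∀ φ (c : C) (v : V), T (φ ∘ₗ LinearMap.mulRight F c) v = T φ (op c • v))
    (h3 : ∀ φ (c : C) (v : V), T (LinearMap.mulRight F c ∘ₗ φ) v = op c • T φ v)
    (h4 : T LinearMap.id = LinearMap.id) (a : Fin (m+2) → TrivSqZeroExt C V) :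
    (a 0).fst • GG T f 0 (Fin.tail a)
      + ∑ i : Fin (m+1), (-1 : ℤ) ^ ((i : ℕ) + 1) •
        GG T f 0 (Fin.contractNth i.castSucc (· * ·) a)
      + (-1 : ℤ) ^ (m+2) • (op (a (Fin.last (m+1))).fst • GG T f 0 (Fin.init a))
      + op (f (fun k => (Fin.tail a k).fst)) • (a 0).snd = 0 := by
  obtain ⟨l, b, rfl⟩ : ∃ r b, a = Fin.cons r b := ⟨a 0, Fin.tail a, (Fin.cons_self_tail a).symm⟩
  have h5 : ∀ (c : C) (v : V), T (LinearMap.mulRight F c) v = op c • v := by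
    intro c v
    have := h2 LinearMap.id c v
    rwa [LinearMap.id_comp, h4] at this
  have h := congrArg (fun ψ => T ψ l.snd) (eqL f hf (fun k => (b k).fst))
  simp only [map_add, map_sub, map_sum, map_zsmul, map_zero, LinearMap.add_apply,
    LinearMap.sub_apply, LinearMap.sum_apply, LinearMap.smul_apply, h2, h3, h5,
    LinearMap.zero_apply] at h
  have hb : GG T f 0 b = T (φL f (fun k => (Fin.tail b k).fst)) (b 0).snd := by
    rw [← GG_cons, Fin.cons_self_tail]
  rw [Fin.sum_univ_succ]
  simp only [Fin.castSucc_zero, ← Fin.succ_castSucc, contract_succ_cons,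
      contract_zero_cons, init_cons, Fin.tail_cons, Fin.cons_zero, ← Fin.succ_last, Fin.cons_succ,
      Fin.val_zero, Fin.val_succ, zero_add, pow_one, neg_smul, one_smul, GG_cons, hb,
      fst_contract, TrivSqZeroExt.snd_mul, map_add, h1]
  rw [← h]
  have e1 : (fun k => (Fin.tail b k).fst) = Fin.tail (fun k => (b k).fst) := rfl
  have e2 : (fun k => (Fin.init b k).fst) = Fin.init (fun k => (b k).fst) := rfl
  rw [e1, e2]
  abel

theorem dGR {m : ℕ} (f : ML F C (m+1)) (hf : ∀ a, dfun f a = 0)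
    (T : (C →ₗ[F] C) →ₗ[F] (V →ₗ[F] V))
    (h1 : ∀ φ (c : C) (v : V), T φ (op c • v) = op c • T φ v)
    (h2 : ∀ φ (c : C) (v : V), T (φ ∘ₗ LinearMap.mulLeft F c) v = T φ (c • v))
    (h3 : ∀ φ (c : C) (v : V), T (LinearMap.mulLeft F c ∘ₗ φ) v = c • T φ v)
    (h4 : T LinearMap.id = LinearMap.id) (a : Fin (m+2) → TrivSqZeroExt C V) :
    (a 0).fst • GG T f (Fin.last m) (Fin.tail a)
      + ∑ i : Fin (m+1), (-1 : ℤ) ^ ((i : ℕ) + 1) •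
        GG T f (Fin.last m) (Fin.contractNth i.castSucc (· * ·) a)
      + (-1 : ℤ) ^ (m+2) • (op (a (Fin.last (m+1))).fst • GG T f (Fin.last m) (Fin.init a))
      + (-1 : ℤ) ^ (m+2) • (f (fun k => (Fin.init a k).fst) • (a (Fin.last (m+1))).snd) = 0 := by
  obtain ⟨b, l, rfl⟩ : ∃ (b : Fin (m+1) → TrivSqZeroExt C V) (r : TrivSqZeroExt C V),
    a = Fin.snoc b r := ⟨Fin.init a, a (Fin.last _), (Fin.snoc_init_self a).symm⟩
  have h5 : ∀ (c : C) (v : V), T (LinearMap.mulLeft F c) v = c • v := by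
    intro c v
    have := h2 LinearMap.id c v
    rwa [LinearMap.id_comp, h4] at this
  have h := congrArg (fun ψ => T ψ l.snd) (eqR f hf (fun k => (b k).fst))
  simp only [map_add, map_sub, map_sum, map_zsmul, map_zero, LinearMap.add_apply,
    LinearMap.sub_apply, LinearMap.sum_apply, LinearMap.smul_apply, h2, h3, h5,
    LinearMap.zero_apply] at h
  have hb : GG T f (Fin.last m) b =
      T (φR f (fun k => (Fin.init b k).fst)) (b (Fin.last m)).snd := by
    rw [← GG_snoc, Fin.snoc_init_self]
  have e0 : (Fin.snoc b l : Fin (m+2) → TrivSqZeroExt C V) 0 = b 0 := by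
    rw [← Fin.castSucc_zero]; exact Fin.snoc_castSucc (α := fun _ => TrivSqZeroExt C V) _ _ _
  rw [Fin.sum_univ_castSucc]
  simp only [contract_last_snoc, contract_castSucc_snoc, tail_snoc, Fin.init_snoc, Fin.snoc_last,
    e0, Fin.val_castSucc, Fin.val_last, GG_snoc, hb,
      fst_contract, TrivSqZeroExt.snd_mul, map_add, h1, smul_add]
  rw [← h]
  have e1 : (fun k => (Fin.tail b k).fst) = Fin.tail (fun k => (b k).fst) := rfl
  have e2 : (fun k => (Fin.init b k).fst) = Fin.init (fun k => (b k).fst) := rfl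
  rw [e1, e2]
  simp only [pow_succ _ (m+1), mul_neg, mul_one, neg_smul]
  abel

/-- The extension of a cocycle. -/
def ext0 {m : ℕ} (f : ML F C (m+1)) (T T' : (C →ₗ[F] C) →ₗ[F] (V →ₗ[F] V)) :
    ML F (TrivSqZeroExt C V) (m+1) :=
  ((TrivSqZeroExt.inlAlgHom F C V).toLinearMap).compMultilinearMap
    (f.compLinearMap (fun _ => (TrivSqZeroExt.fstHom F C V).toLinearMap))
  + ((TrivSqZeroExt.inrHom C V).restrictScalars F).compMultilinearMap
    (GG T f 0 + GG T' f (Fin.last m))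

theorem ext0_apply {m : ℕ} (f : ML F C (m+1)) (T T' : (C →ₗ[F] C) →ₗ[F] (V →ₗ[F] V))
    (a : Fin (m+1) → TrivSqZeroExt C V) : ext0 f T T' a =
      TrivSqZeroExt.inl (f (fun k => (a k).fst)) +
      TrivSqZeroExt.inr (GG T f 0 a + GG T' f (Fin.last m) a) := rfl

theorem ext0_inl {m : ℕ} (f : ML F C (m+1)) (T T' : (C →ₗ[F] C) →ₗ[F] (V →ₗ[F] V))
    (a : Fin (m+1) → C) : ext0 f T T' (fun k => TrivSqZeroExt.inl (a k)) =
      TrivSqZeroExt.inl (f a) := by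
  rw [ext0_apply]
  have e : ∀ (T : (C →ₗ[F] C) →ₗ[F] (V →ₗ[F] V)) (q : Fin (m+1)),
      GG T f q (fun k => TrivSqZeroExt.inl (a k)) = 0 := by
    intro T q
    show T _ (TrivSqZeroExt.snd (TrivSqZeroExt.inl (a q))) = 0
    rw [TrivSqZeroExt.snd_inl, map_zero]
  simp [e]

theorem ext0_cocycle {m : ℕ} (f : ML F C (m+1)) (hf : ∀ a, dfun f a = 0)
    (T T' : (C →ₗ[F] C) →ₗ[F] (V →ₗ[F] V))
    (h1 : ∀ φ (c : C) (v : V), T φ (c • v) = c • T φ v)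
    (h2 : ∀ φ (c : C) (v : V), T (φ ∘ₗ LinearMap.mulRight F c) v = T φ (op c • v))
    (h3 : ∀ φ (c : C) (v : V), T (LinearMap.mulRight F c ∘ₗ φ) v = op c • T φ v)
    (h4 : T LinearMap.id = LinearMap.id)
    (h1' : ∀ φ (c : C) (v : V), T' φ (op c • v) = op c • T' φ v)
    (h2' : ∀ φ (c : C) (v : V), T' (φ ∘ₗ LinearMap.mulLeft F c) v = T' φ (c • v))
    (h3' : ∀ φ (c : C) (v : V), T' (LinearMap.mulLeft F c ∘ₗ φ) v = c • T' φ v)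
    (h4' : T' LinearMap.id = LinearMap.id) (a : Fin (m+2) → TrivSqZeroExt C V) :
    dfun (ext0 f T T') a = 0 := by
  have e1 := dGL f hf T h1 h2 h3 h4 a
  have e2 := dGR f hf T' h1' h2' h3' h4' a
  have e3 := hf (fun k => (a k).fst)
  rw [dfun] at e3 ⊢
  refine TrivSqZeroExt.ext ?_ ?_
  · simp only [TrivSqZeroExt.fst_add, TrivSqZeroExt.fst_mul, TrivSqZeroExt.fst_sum,
      TrivSqZeroExt.fst_smul, ext0_apply, TrivSqZeroExt.fst_inl, TrivSqZeroExt.fst_inr, add_zero,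
      fst_contract, TrivSqZeroExt.fst_zero]
    exact e3
  · simp only [TrivSqZeroExt.snd_add, TrivSqZeroExt.snd_mul, TrivSqZeroExt.snd_sum,
      TrivSqZeroExt.snd_smul, ext0_apply, TrivSqZeroExt.fst_inl, TrivSqZeroExt.fst_inr, add_zero,
      TrivSqZeroExt.fst_add, TrivSqZeroExt.snd_inl, TrivSqZeroExt.snd_inr, zero_add,
      fst_contract, TrivSqZeroExt.snd_zero, smul_add, Finset.sum_add_distrib, smul_zero,
      Finset.sum_const_zero]
    have := congrArg₂ (· + ·) e1 e2
    simp only [add_zero] at this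
    refine Eq.trans ?_ this
    abel

section TTsec
variable {S X : Type} [Ring S] [Algebra F S] [AddCommGroup X] [Module F X] [Module S X]
  [IsScalarTower F S X]

/-- The operator attached to a section of the canonical surjection from a free module. -/
def TT (s : X →ₗ[S] (X →₀ S)) : (S →ₗ[F] S) →ₗ[F] (X →ₗ[F] X) where
  toFun U := (Finsupp.linearCombination S (id : X → X)).restrictScalars F ∘ₗ
    Finsupp.mapRange.linearMap U ∘ₗ s.restrictScalars F
  map_add' U U' := by
    ext x
    have : Finsupp.mapRange.linearMap (α := X) (U + U') =
      Finsupp.mapRange.linearMap U + Finsupp.mapRange.linearMap U' := by ext; simp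
    simp [this, -Finsupp.mapRange.linearMap_apply]
  map_smul' c U := by
    ext x
    have : Finsupp.mapRange.linearMap (α := X) (c • U) =
      c • Finsupp.mapRange.linearMap U := by ext; simp
    rw [this]
    simp only [LinearMap.comp_apply, LinearMap.smul_apply, map_smul, RingHom.id_apply]

theorem TT_apply (s : X →ₗ[S] (X →₀ S)) (U : S →ₗ[F] S) (x : X) :
    TT s U x = Finsupp.linearCombination S (id : X → X) (Finsupp.mapRange U (map_zero U) (s x)) :=
  rfl

theorem TT_smul (s : X →ₗ[S] (X →₀ S)) (U : S →ₗ[F] S) (c : S) (x : X)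
    (h : ∀ z, U (c * z) = c * U z) : TT s U (c • x) = c • TT s U x := by
  rw [TT_apply, TT_apply, map_smul, ← map_smul (Finsupp.linearCombination S (id : X → X))]
  congr 1; ext y; simp [h]

theorem TT_pre (s : X →ₗ[S] (X →₀ S)) (U U' : S →ₗ[F] S) (c : S) (x : X)
    (h : ∀ z, U' z = U (c * z)) : TT s U' x = TT s U (c • x) := by
  rw [TT_apply, TT_apply, map_smul]
  congr 1; ext y; simp [h]

theorem TT_post (s : X →ₗ[S] (X →₀ S)) (U U' : S →ₗ[F] S) (c : S) (x : X)
    (h : ∀ z, U' z = c * U z) : TT s U' x = c • TT s U x := by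
  rw [TT_apply, TT_apply, ← map_smul (Finsupp.linearCombination S (id : X → X))]
  congr 1; ext y; simp [h]

theorem TT_id (s : X →ₗ[S] (X →₀ S))
    (hs : Finsupp.linearCombination S (id : X → X) ∘ₗ s = LinearMap.id) :
    TT (F := F) s LinearMap.id = LinearMap.id := by
  ext x
  rw [TT_apply]
  have := LinearMap.congr_fun hs x
  simpa using this
end TTsec

section corner
attribute [-instance] cornerModuleN cornerTowerN envModule
variable {P Q X : Type} [Ring P] [Ring Q] [Algebra F P] [Algebra F Q] [AddCommGroup X]
  [Module F X] [Module P X] [Module Qᵐᵒᵖ X] [SMulCommClass P Qᵐᵒᵖ X] [IsScalarTower F P X]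
  [IsScalarTower F Qᵐᵒᵖ X]

/-- The opposite of a linear map. -/
def opL : (Q →ₗ[F] Q) →ₗ[F] (Qᵐᵒᵖ →ₗ[F] Qᵐᵒᵖ) where
  toFun φ := (opLinearEquiv F).toLinearMap ∘ₗ φ ∘ₗ (opLinearEquiv F).symm.toLinearMap
  map_add' _ _ := rfl
  map_smul' _ _ := rfl

theorem opL_apply (φ : Q →ₗ[F] Q) (y : Qᵐᵒᵖ) : opL φ y = op (φ (unop y)) := rfl

theorem corner_smulL (p : P) (x : X) : ((p ⊗ₜ 1 : P ⊗[F] Qᵐᵒᵖ)) • x = p • x := by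
  show TensorProduct.Algebra.moduleAux _ _ = _
  rw [TensorProduct.Algebra.moduleAux_apply, one_smul]

theorem corner_smulR (q : Qᵐᵒᵖ) (x : X) : ((1 ⊗ₜ q : P ⊗[F] Qᵐᵒᵖ)) • x = q • x := by
  show TensorProduct.Algebra.moduleAux _ _ = _
  rw [TensorProduct.Algebra.moduleAux_apply, one_smul]

theorem corner_exists (hX : Module.Projective (P ⊗[F] Qᵐᵒᵖ) X) :
    (∃ T : (Q →ₗ[F] Q) →ₗ[F] (X →ₗ[F] X),
      (∀ φ (c : P) (v : X), T φ (c • v) = c • T φ v) ∧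
      (∀ φ (c : Q) (v : X), T (φ ∘ₗ LinearMap.mulRight F c) v = T φ (op c • v)) ∧
      (∀ φ (c : Q) (v : X), T (LinearMap.mulRight F c ∘ₗ φ) v = op c • T φ v) ∧
      T LinearMap.id = LinearMap.id) ∧
    (∃ T : (P →ₗ[F] P) →ₗ[F] (X →ₗ[F] X),
      (∀ φ (c : Q) (v : X), T φ (op c • v) = op c • T φ v) ∧
      (∀ φ (c : P) (v : X), T (φ ∘ₗ LinearMap.mulLeft F c) v = T φ (c • v)) ∧
      (∀ φ (c : P) (v : X), T (LinearMap.mulLeft F c ∘ₗ φ) v = c • T φ v) ∧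
      T LinearMap.id = LinearMap.id) := by
  obtain ⟨s, hs⟩ := Module.projective_def'.mp hX
  constructor
  · refine ⟨TT s ∘ₗ LinearMap.lTensorHom P ∘ₗ opL, ?_, ?_, ?_, ?_⟩
    · intro φ c v
      rw [← corner_smulL (F := F) (Q := Q) c v, ← corner_smulL (F := F) (Q := Q) c]
      refine TT_smul s _ _ _ fun z => ?_
      induction z using TensorProduct.induction_on with
      | zero => simp
      | add x y hx hy => rw [mul_add, map_add, hx, hy, map_add, mul_add]
      | tmul x y => simp
    · intro φ c v
      rw [← corner_smulR (F := F) (P := P) (op c) v]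
      refine TT_pre s _ _ _ _ fun z => ?_
      induction z using TensorProduct.induction_on with
      | zero => simp
      | add x y hx hy => rw [mul_add, map_add, hx, hy, map_add]
      | tmul x y => simp [opL_apply]
    · intro φ c v
      rw [← corner_smulR (F := F) (P := P) (op c)]
      refine TT_post s _ _ _ _ fun z => ?_
      induction z using TensorProduct.induction_on with
      | zero => simp
      | add x y hx hy => rw [map_add, hx, hy, map_add, mul_add]
      | tmul x y => simp [opL_apply]
    · rw [← TT_id (F := F) s hs]
      refine congrArg (TT s) ?_
      ext x y
      simp [opL_apply]
  · refine ⟨TT s ∘ₗ LinearMap.rTensorHom Qᵐᵒᵖ, ?_, ?_, ?_, ?_⟩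
    · intro φ c v
      rw [← corner_smulR (F := F) (P := P) (op c) v, ← corner_smulR (F := F) (P := P) (op c)]
      refine TT_smul s _ _ _ fun z => ?_
      induction z using TensorProduct.induction_on with
      | zero => simp
      | add x y hx hy => rw [mul_add, map_add, hx, hy, map_add, mul_add]
      | tmul x y => simp
    · intro φ c v
      rw [← corner_smulL (F := F) (Q := Q) c v]
      refine TT_pre s _ _ _ _ fun z => ?_
      induction z using TensorProduct.induction_on with
      | zero => simp
      | add x y hx hy => rw [mul_add, map_add, hx, hy, map_add]
      | tmul x y => simp
    · intro φ c v
      rw [← corner_smulL (F := F) (Q := Q) c]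
      refine TT_post s _ _ _ _ fun z => ?_
      induction z using TensorProduct.induction_on with
      | zero => simp
      | add x y hx hy => rw [map_add, hx, hy, map_add, mul_add]
      | tmul x y => simp
    · rw [← TT_id (F := F) s hs]
      refine congrArg (TT s) ?_
      ext x y
      simp
end corner

end HHBarSec7
end HHBar

namespace HHBar
section HHBarSec8

theorem null_existsL
    (TM : (A →ₗ[k] A) →ₗ[k] (M →ₗ[k] M))
    (m1 : ∀ φ (c : B) (v : M), TM φ (c • v) = c • TM φ v)
    (m2 : ∀ φ (c : A) (v : M), TM (φ ∘ₗ LinearMap.mulRight k c) v = TM φ (op c • v))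
    (m3 : ∀ φ (c : A) (v : M), TM (LinearMap.mulRight k c ∘ₗ φ) v = op c • TM φ v)
    (m4 : TM LinearMap.id = LinearMap.id)
    (TN : (B →ₗ[k] B) →ₗ[k] (N →ₗ[k] N))
    (n1 : ∀ φ (c : A) (v : N), TN φ (c • v) = c • TN φ v)
    (n2 : ∀ φ (c : B) (v : N), TN (φ ∘ₗ LinearMap.mulRight k c) v = TN φ (op c • v))
    (n3 : ∀ φ (c : B) (v : N), TN (LinearMap.mulRight k c ∘ₗ φ) v = op c • TN φ v)
    (n4 : TN LinearMap.id = LinearMap.id) :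
    ∃ T : ((A × B) →ₗ[k] (A × B)) →ₗ[k] ((M × N) →ₗ[k] (M × N)),
      (∀ φ (c : A × B) (v : M × N), T φ (c • v) = c • T φ v) ∧
      (∀ φ (c : A × B) (v : M × N), T (φ ∘ₗ LinearMap.mulRight k c) v = T φ (op c • v)) ∧
      (∀ φ (c : A × B) (v : M × N), T (LinearMap.mulRight k c ∘ₗ φ) v = op c • T φ v) ∧
      T LinearMap.id = LinearMap.id := by
  refine ⟨{ toFun := fun φ => LinearMap.prodMap
              (TM (LinearMap.fst k A B ∘ₗ φ ∘ₗ LinearMap.inl k A B))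
              (TN (LinearMap.snd k A B ∘ₗ φ ∘ₗ LinearMap.inr k A B))
            map_add' := ?_, map_smul' := ?_ }, ?_, ?_, ?_, ?_⟩
  · intro φ ψ
    simp only [LinearMap.add_comp, LinearMap.comp_add, map_add, LinearMap.prodMap_add]
  · intro c φ
    simp only [LinearMap.smul_comp, LinearMap.comp_smul, map_smul, LinearMap.prodMap_smul,
      RingHom.id_apply]
  · rintro φ c v
    exact Prod.ext (m1 _ c.2 v.1) (n1 _ c.1 v.2)
  · rintro φ c v
    refine Prod.ext ((congrArg (fun ψ => TM ψ v.1) ?_).trans (m2 _ c.1 v.1))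
      ((congrArg (fun ψ => TN ψ v.2) ?_).trans (n2 _ c.2 v.2))
    · ext x; simp [Prod.mul_def]
    · ext x; simp [Prod.mul_def]
  · rintro φ c v
    refine Prod.ext ((congrArg (fun ψ => TM ψ v.1) ?_).trans (m3 _ c.1 v.1))
      ((congrArg (fun ψ => TN ψ v.2) ?_).trans (n3 _ c.2 v.2))
    · ext x; simp [Prod.mul_def]
    · ext x; simp [Prod.mul_def]
  · have e1 : LinearMap.fst k A B ∘ₗ LinearMap.id ∘ₗ LinearMap.inl k A B = LinearMap.id := by
      ext x; simp
    have e2 : LinearMap.snd k A B ∘ₗ LinearMap.id ∘ₗ LinearMap.inr k A B = LinearMap.id := by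
      ext x; simp
    show LinearMap.prodMap (TM (_ ∘ₗ _ ∘ₗ _)) (TN (_ ∘ₗ _ ∘ₗ _)) = _
    rw [e1, e2, m4, n4]
    rfl

theorem null_existsR
    (TM : (B →ₗ[k] B) →ₗ[k] (M →ₗ[k] M))
    (m1 : ∀ φ (c : A) (v : M), TM φ (op c • v) = op c • TM φ v)
    (m2 : ∀ φ (c : B) (v : M), TM (φ ∘ₗ LinearMap.mulLeft k c) v = TM φ (c • v))
    (m3 : ∀ φ (c : B) (v : M), TM (LinearMap.mulLeft k c ∘ₗ φ) v = c • TM φ v)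
    (m4 : TM LinearMap.id = LinearMap.id)
    (TN : (A →ₗ[k] A) →ₗ[k] (N →ₗ[k] N))
    (n1 : ∀ φ (c : B) (v : N), TN φ (op c • v) = op c • TN φ v)
    (n2 : ∀ φ (c : A) (v : N), TN (φ ∘ₗ LinearMap.mulLeft k c) v = TN φ (c • v))
    (n3 : ∀ φ (c : A) (v : N), TN (LinearMap.mulLeft k c ∘ₗ φ) v = c • TN φ v)
    (n4 : TN LinearMap.id = LinearMap.id) :
    ∃ T : ((A × B) →ₗ[k] (A × B)) →ₗ[k] ((M × N) →ₗ[k] (M × N)),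
      (∀ φ (c : A × B) (v : M × N), T φ (op c • v) = op c • T φ v) ∧
      (∀ φ (c : A × B) (v : M × N), T (φ ∘ₗ LinearMap.mulLeft k c) v = T φ (c • v)) ∧
      (∀ φ (c : A × B) (v : M × N), T (LinearMap.mulLeft k c ∘ₗ φ) v = c • T φ v) ∧
      T LinearMap.id = LinearMap.id := by
  refine ⟨{ toFun := fun φ => LinearMap.prodMap
              (TM (LinearMap.snd k A B ∘ₗ φ ∘ₗ LinearMap.inr k A B))
              (TN (LinearMap.fst k A B ∘ₗ φ ∘ₗ LinearMap.inl k A B))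
            map_add' := ?_, map_smul' := ?_ }, ?_, ?_, ?_, ?_⟩
  · intro φ ψ
    simp only [LinearMap.add_comp, LinearMap.comp_add, map_add, LinearMap.prodMap_add]
  · intro c φ
    simp only [LinearMap.smul_comp, LinearMap.comp_smul, map_smul, LinearMap.prodMap_smul,
      RingHom.id_apply]
  · rintro φ c v
    exact Prod.ext (m1 _ c.1 v.1) (n1 _ c.2 v.2)
  · rintro φ c v
    refine Prod.ext ((congrArg (fun ψ => TM ψ v.1) ?_).trans (m2 _ c.2 v.1))
      ((congrArg (fun ψ => TN ψ v.2) ?_).trans (n2 _ c.1 v.2))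
    · ext x; simp [Prod.mul_def]
    · ext x; simp [Prod.mul_def]
  · rintro φ c v
    refine Prod.ext ((congrArg (fun ψ => TM ψ v.1) ?_).trans (m3 _ c.2 v.1))
      ((congrArg (fun ψ => TN ψ v.2) ?_).trans (n3 _ c.1 v.2))
    · ext x; simp [Prod.mul_def]
    · ext x; simp [Prod.mul_def]
  · have e1 : LinearMap.fst k A B ∘ₗ LinearMap.id ∘ₗ LinearMap.inl k A B = LinearMap.id := by
      ext x; simp
    have e2 : LinearMap.snd k A B ∘ₗ LinearMap.id ∘ₗ LinearMap.inr k A B = LinearMap.id := by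
      ext x; simp
    show LinearMap.prodMap (TM (_ ∘ₗ _ ∘ₗ _)) (TN (_ ∘ₗ _ ∘ₗ _)) = _
    rw [e1, e2, m4, n4]
    rfl

/-- The product of two cochains. -/
def prodC {n : ℕ} (f : ML k A n) (g : ML k B n) : ML k (A × B) n :=
  (f.compLinearMap (fun _ => LinearMap.fst k A B)).prod
    (g.compLinearMap (fun _ => LinearMap.snd k A B))

theorem prodC_cocycle {n : ℕ} (f : ML k A n) (g : ML k B n) (hf : ∀ a, dfun f a = 0)
    (hg : ∀ a, dfun g a = 0) (c : Fin (n+1) → A × B) : dfun (prodC k A B f g) c = 0 := by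
  have e : ∀ c, prodC k A B f g c = (f (fun j => (c j).1), g (fun j => (c j).2)) := fun _ => rfl
  have c1 : ∀ j : Fin (n+1), (fun i => (Fin.contractNth j (· * ·) c i).1) =
      Fin.contractNth j (· * ·) (fun i => (c i).1) := by
    intro j; funext i; simp only [Fin.contractNth]; split_ifs <;> rfl
  have c2 : ∀ j : Fin (n+1), (fun i => (Fin.contractNth j (· * ·) c i).2) =
      Fin.contractNth j (· * ·) (fun i => (c i).2) := by
    intro j; funext i; simp only [Fin.contractNth]; split_ifs <;> rfl
  rw [dfun]
  refine Prod.ext ?_ ?_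
  · have := hf (fun i => (c i).1)
    rw [dfun] at this
    simp only [Prod.fst_add, Prod.fst_mul, Prod.fst_sum, Prod.smul_fst, e, c1, Prod.fst_zero]
    exact this
  · have := hg (fun i => (c i).2)
    rw [dfun] at this
    simp only [Prod.snd_add, Prod.snd_mul, Prod.snd_sum, Prod.smul_snd, e, c2, Prod.snd_zero]
    exact this

theorem final
    (hM : Module.Projective (B ⊗[k] Aᵐᵒᵖ) M)
    (hN : Module.Projective (A ⊗[k] Bᵐᵒᵖ) N) (m : ℕ) :
      Module.rank k (HHt k A (m+1)) + Module.rank k (HHt k B (m+1)) ≤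
        Module.rank k (HHt k (NullSq A B M N) (m+1)) := by
  obtain ⟨⟨TM, m1, m2, m3, m4⟩, ⟨TM', m1', m2', m3', m4'⟩⟩ :=
    corner_exists (F := k) (P := B) (Q := A) (X := M) hM
  obtain ⟨⟨TN, n1, n2, n3, n4⟩, ⟨TN', n1', n2', n3', n4'⟩⟩ :=
    corner_exists (F := k) (P := A) (Q := B) (X := N) hN
  obtain ⟨T, h1, h2, h3, h4⟩ := null_existsL k A B M N TM m1 m2 m3 m4 TN n1 n2 n3 n4
  obtain ⟨T', h1', h2', h3', h4'⟩ :=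
    null_existsR k A B M N TM' m1' m2' m3' m4' TN' n1' n2' n3' n4'
  refine rank_ineq (F := k)
    ((TrivSqZeroExt.inlAlgHom k (A × B) (M × N)).toLinearMap ∘ₗ LinearMap.inl k A B)
    (LinearMap.fst k A B ∘ₗ (TrivSqZeroExt.fstHom k (A × B) (M × N)).toLinearMap)
    ?_ ?_ ?_
    ((TrivSqZeroExt.inlAlgHom k (A × B) (M × N)).toLinearMap ∘ₗ LinearMap.inr k A B)
    (LinearMap.snd k A B ∘ₗ (TrivSqZeroExt.fstHom k (A × B) (M × N)).toLinearMap)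
    ?_ ?_ ?_ m ?_
  · intro x y
    refine TrivSqZeroExt.ext ?_ ?_ <;> simp
  · intro x y; simp
  · intro x y; simp
  · intro x y
    refine TrivSqZeroExt.ext ?_ ?_ <;> simp
  · intro x y; simp
  · intro x y; simp
  · intro f hf g hg
    rw [mem_Zc] at hf hg
    refine ⟨ext0 (prodC k A B f g) T T', ?_, ?_, ?_⟩
    · rw [mem_Zc]
      exact ext0_cocycle _ (prodC_cocycle k A B f g hf hg) T T' h1 h2 h3 h4 h1' h2' h3' h4'
    · intro a
      have := ext0_inl (prodC k A B f g) T T' (fun j => ((a j, 0) : A × B))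
      exact congrArg (fun z => z.fst.1) this
    · intro b
      have := ext0_inl (prodC k A B f g) T T' (fun j => ((0, b j) : A × B))
      exact congrArg (fun z => z.fst.2) this

end HHBarSec8
end HHBar

/-- for a finite-dimensional null-square projective algebra
`Λ = [[A,N],[M,B]]` and every `n > 0`,
`dim_k HH^n(Λ) ≥ dim_k HH^n(A) + dim_k HH^n(B)`. -/
theorem stmt_6
    [FiniteDimensional k A] [FiniteDimensional k B]
    [FiniteDimensional k M] [FiniteDimensional k N]
    (hM : Module.Projective (B ⊗[k] Aᵐᵒᵖ) M)
    (hN : Module.Projective (A ⊗[k] Bᵐᵒᵖ) N) :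
    ∀ n : ℕ, 0 < n →
      Module.rank k (HHt k A n) + Module.rank k (HHt k B n) ≤
        Module.rank k (HHt k (NullSq A B M N) n) := by
  intro n hn
  obtain ⟨m, rfl⟩ := Nat.exists_eq_succ_of_ne_zero hn.ne'
  exact HHBar.final k A B M N hM hN m

end
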